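/- arXiv:2503.20137 — 3 statements merged into one kernel-verified Lean document; each statement's English description precedes it below -/
import Mathlib

section
/- Let q be an odd prime power, n = 2q+2, ξ ∈ F_{q^2} a primitive n-th root of unity, and let C ⊆ F_q^n be the cyclic code C = {c ∈ F_q^n : c(α) = 0 for every α ∈ {1, ξ, ξ^{-1}, ξ^q, ξ^{-q}, ξ^2, ξ^{2q}}, evaluation in F_{q^2}}. Then for every integer ℓ with 5 ≤ ℓ ≤ n-3, there is no codeword c ∈ C whose support is exactly {0, 1, 2, 3, ℓ, ℓ+1}; equivalently, C contains no codeword of the form (⋆,⋆,⋆,⋆,0_r,⋆,⋆,0_{n-r-6}) with each ⋆ a nonzero element of F_q and 1 ≤ r ≤ n-7. -/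
/-- A word supported on `{0, 1, 2, 3, 2m, 2m+1}` whose even and odd parts vanish at `ξ^{±1}`
cannot vanish at `β^{±1}`, where `β = ξ²` and `y = β^m`; `B` and `Y` are the inverses of
`β` and `y`. -/
lemma no_codeword_even {K : Type*} [Field K] {c0 c1 c2 c3 a b β B y Y : K}
    (hB : β * B = 1) (hY : y * Y = 1) (hc0 : c0 ≠ 0) (hc2 : c2 ≠ 0) (ha : a ≠ 0)
    (hβ2 : β ^ 2 ≠ 1) (hβ3 : β ^ 3 ≠ 1)
    (hn : c0 + c1 * β ≠ 0) (hn' : c0 + c1 * B ≠ 0)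
    (e1 : c0 + c2 * β + a * y = 0) (e2 : c0 + c2 * B + a * Y = 0)
    (o1 : c1 + c3 * β + b * y = 0) (o2 : c1 + c3 * B + b * Y = 0)
    (h1 : c0 + c1 * β + c2 * β ^ 2 + c3 * β ^ 3 + a * y ^ 2 + b * (y ^ 2 * β) = 0)
    (h2 : c0 + c1 * B + c2 * B ^ 2 + c3 * B ^ 3 + a * Y ^ 2 + b * (Y ^ 2 * B) = 0) :
    False := by
  have hs : β - B ≠ 0 := fun h => hβ2 (by linear_combination β * h + hB)
  have p2 : b * c2 = a * c3 := by
    have : (β - B) * (b * c2 - a * c3) = 0 := by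
      linear_combination b * e1 - a * o1 - b * e2 + a * o2
    linear_combination (mul_eq_zero.1 this).resolve_left hs
  have p0 : b * c0 = a * c1 := by linear_combination b * e1 - a * o1 - β * p2
  have p3 : c0 * c3 = c1 * c2 :=
    mul_left_cancel₀ ha (by linear_combination c2 * p0 - c0 * p2)
  have g1 : c0 + c2 * β ^ 2 + a * y ^ 2 = 0 := by
    have : (c0 + c1 * β) * (c0 + c2 * β ^ 2 + a * y ^ 2) = 0 := by
      linear_combination c0 * h1 - β ^ 3 * p3 - y ^ 2 * β * p0
    exact (mul_eq_zero.1 this).resolve_left hn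
  have g2 : c0 + c2 * B ^ 2 + a * Y ^ 2 = 0 := by
    have : (c0 + c1 * B) * (c0 + c2 * B ^ 2 + a * Y ^ 2) = 0 := by
      linear_combination c0 * h2 - B ^ 3 * p3 - Y ^ 2 * B * p0
    exact (mul_eq_zero.1 this).resolve_left hn'
  have n1 : (c0 + c2 * β) * (c0 + c2 * B) = a ^ 2 := by
    linear_combination (c0 + c2 * B) * e1 - a * y * e2 + a ^ 2 * hY
  have n2 : (c0 + c2 * β ^ 2) * (c0 + c2 * B ^ 2) = a ^ 2 := by
    linear_combination (c0 + c2 * B ^ 2) * g1 - a * y ^ 2 * g2 + a ^ 2 * (y * Y + 1) * hY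
  have key : c0 * c2 * (β ^ 2 + B ^ 2 - β - B) = 0 := by
    linear_combination n2 - n1 + c2 ^ 2 * hB - c2 ^ 2 * (β * B + 1) * hB
  have key' : (β ^ 3 - 1) * (β - 1) = 0 := by
    have := (mul_eq_zero.1 key).resolve_left (mul_ne_zero hc0 hc2)
    linear_combination β ^ 2 * this - (β * B + 1) * hB + β * hB
  rcases mul_eq_zero.1 key' with h | h
  · exact hβ3 (sub_eq_zero.1 h)
  · exact hβ2 (by linear_combination (β + 1) * h)

/-- A word supported on `{0, 1, 2, 3, 2m-1, 2m}` whose even and odd parts vanish at `ξ^{±1}`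
cannot vanish at both `1` and `β`, where `β = ξ²` and `y = β^m`. -/
lemma no_codeword_odd {K : Type*} [Field K] {c0 c1 c2 c3 a b β y : K}
    (hβ : β ≠ 0) (hy : y ≠ 0) (hc0 : c0 ≠ 0) (hc2 : c2 ≠ 0)
    (hb : b ≠ 0) (hβ2 : β ^ 2 ≠ 1)
    (e1 : c0 + c2 * β + b * y = 0) (e2 : c0 * β * y + c2 * y + b * β = 0)
    (o1 : c1 * β + c3 * β ^ 2 + a * y = 0) (o2 : c1 * β * y + c3 * y + a * β ^ 2 = 0)
    (h0 : c0 + c1 + c2 + c3 + a + b = 0)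
    (h1 : c0 * β + c1 * β ^ 2 + c2 * β ^ 3 + c3 * β ^ 4 + a * y ^ 2 + b * y ^ 2 * β = 0) :
    False := by
  have hD : (β ^ 2 - 1) * y ≠ 0 := mul_ne_zero (sub_ne_zero.2 hβ2) hy
  have hβ1 : 1 - β ≠ 0 := fun h => hβ2 (by linear_combination -(β + 1) * h)
  have d0 : c0 * ((β ^ 2 - 1) * y) = b * (y ^ 2 - β ^ 2) := by
    linear_combination β * e2 - y * e1
  have d2 : c2 * ((β ^ 2 - 1) * y) = -b * β * (y ^ 2 - 1) := by
    linear_combination β * y * e1 - e2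
  have d3 : c3 * ((β ^ 2 - 1) * y) = -a * (y ^ 2 - β ^ 2) := by
    linear_combination y * o1 - o2
  have d1 : c1 * β * ((β ^ 2 - 1) * y) = a * (y ^ 2 - β ^ 4) := by
    linear_combination β ^ 2 * o2 - y * o1
  have hy1 : y - 1 ≠ 0 := fun h => mul_ne_zero hc2 hD (by
    linear_combination d2 - b * β * (y + 1) * h)
  have hyβ : y - β ≠ 0 := fun h => mul_ne_zero hc0 hD (by
    linear_combination d0 + b * (y + β) * h)
  have s0 : b * β * (y - 1) + a * (y - β ^ 2) = 0 := by
    have : (1 - β) * (y - β) * (b * β * (y - 1) + a * (y - β ^ 2)) = 0 := by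
      linear_combination β * ((β ^ 2 - 1) * y) * h0 - β * d0 - β * d2 - β * d3 - d1
    exact (mul_eq_zero.1 this).resolve_left (mul_ne_zero hβ1 hyβ)
  have s1 : b * β * (y - 1) * ((β + 1) * y + β)
      + a * (y - β ^ 2) * ((β + 1) * y + β ^ 2) = 0 := by
    have : (1 - β) * (y - β) * (b * β * (y - 1) * ((β + 1) * y + β)
        + a * (y - β ^ 2) * ((β + 1) * y + β ^ 2)) = 0 := by
      linear_combination -((β ^ 2 - 1) * y) * h1 + β * d0 + β ^ 3 * d2 + β ^ 4 * d3 + β * d1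
    exact (mul_eq_zero.1 this).resolve_left (mul_ne_zero hβ1 hyβ)
  have : b * β * (y - 1) * (β * (1 - β)) = 0 := by
    linear_combination s1 - ((β + 1) * y + β ^ 2) * s0
  exact mul_ne_zero (mul_ne_zero (mul_ne_zero hb hβ) hy1) (mul_ne_zero hβ hβ1) this

/-- If a sparse polynomial vanishes at `α` and `-α`, its even and odd parts vanish at `α`;
the case of an even exponent `2m`. -/
lemma parts_vanish_of_even {K : Type*} [Field K] (h2 : (2 : K) ≠ 0) {c0 c1 c2 c3 a b α : K}
    (hα : α ≠ 0) (m : ℕ)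
    (h : c0 + c1 * α + c2 * α ^ 2 + c3 * α ^ 3 + a * α ^ (2 * m) + b * α ^ (2 * m + 1) = 0)
    (h' : c0 + c1 * (-α) + c2 * (-α) ^ 2 + c3 * (-α) ^ 3 + a * (-α) ^ (2 * m)
      + b * (-α) ^ (2 * m + 1) = 0) :
    c0 + c2 * α ^ 2 + a * (α ^ 2) ^ m = 0 ∧ c1 + c3 * α ^ 2 + b * (α ^ 2) ^ m = 0 := by
  simp only [pow_succ _ (2 * m), pow_mul, neg_sq] at h h'
  constructor
  · refine (mul_eq_zero.1 (?_ : (2 : K) * _ = 0)).resolve_left h2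
    linear_combination h + h'
  · refine (mul_eq_zero.1 (?_ : (2 * α) * _ = 0)).resolve_left (mul_ne_zero h2 hα)
    linear_combination h - h'

/-- If a sparse polynomial vanishes at `α` and `-α`, its even and odd parts vanish at `α`;
the case of an odd exponent `2m+1`. -/
lemma parts_vanish_of_odd {K : Type*} [Field K] (h2 : (2 : K) ≠ 0) {c0 c1 c2 c3 a b α : K}
    (hα : α ≠ 0) (m : ℕ)
    (h : c0 + c1 * α + c2 * α ^ 2 + c3 * α ^ 3 + a * α ^ (2 * m + 1)
      + b * α ^ (2 * m + 1 + 1) = 0)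
    (h' : c0 + c1 * (-α) + c2 * (-α) ^ 2 + c3 * (-α) ^ 3 + a * (-α) ^ (2 * m + 1)
      + b * (-α) ^ (2 * m + 1 + 1) = 0) :
    c0 + c2 * α ^ 2 + b * ((α ^ 2) ^ m * α ^ 2) = 0 ∧ c1 + c3 * α ^ 2 + a * (α ^ 2) ^ m = 0 := by
  simp only [pow_succ _ (2 * m + 1), pow_succ _ (2 * m), pow_mul, neg_sq] at h h'
  constructor
  · refine (mul_eq_zero.1 (?_ : (2 : K) * _ = 0)).resolve_left h2
    linear_combination h + h'
  · refine (mul_eq_zero.1 (?_ : (2 * α) * _ = 0)).resolve_left (mul_ne_zero h2 hα)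
    linear_combination h - h'

/-- A sum over `Fin n` of a function supported on `{0, 1, 2, 3, ℓ, ℓ+1}`. -/
lemma sum_fin_eq_of_support {K : Type*} [AddCommMonoid K] {n ℓ : ℕ} (hl : 4 ≤ ℓ)
    (hn : ℓ + 1 < n) (f : Fin n → K)
    (hf : ∀ i : Fin n, ¬ ((i : ℕ) = 0 ∨ (i : ℕ) = 1 ∨ (i : ℕ) = 2 ∨ (i : ℕ) = 3 ∨
          (i : ℕ) = ℓ ∨ (i : ℕ) = ℓ + 1) → f i = 0) :
    ∑ i, f i = f ⟨0, by omega⟩ + f ⟨1, by omega⟩ + f ⟨2, by omega⟩ + f ⟨3, by omega⟩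
      + f ⟨ℓ, by omega⟩ + f ⟨ℓ + 1, hn⟩ := by
  rw [← Finset.sum_subset (Finset.subset_univ
    ({⟨0, by omega⟩, ⟨1, by omega⟩, ⟨2, by omega⟩, ⟨3, by omega⟩, ⟨ℓ, by omega⟩,
      ⟨ℓ + 1, hn⟩} : Finset (Fin n)))]
  · rw [Finset.sum_insert, Finset.sum_insert, Finset.sum_insert, Finset.sum_insert,
      Finset.sum_insert, Finset.sum_singleton]
    · simp only [add_assoc]
    all_goals
      simp only [Finset.mem_insert, Finset.mem_singleton, Fin.mk.injEq]
      omega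
  · intro i _ hi
    apply hf
    simpa only [Finset.mem_insert, Finset.mem_singleton, Fin.ext_iff] using hi


/-- For an odd prime power `q` and `n = 2q+2`, the cyclic code
`C = {c ∈ F_q^n : c(α) = 0 for all α ∈ {1, ξ, ξ⁻¹, ξ^q, ξ^{-q}, ξ^2, ξ^{2q}}}` contains,
for every `5 ≤ ℓ ≤ n-3`, no codeword whose support is exactly `{0, 1, 2, 3, ℓ, ℓ+1}`. -/
theorem stmt_12 (q : ℕ) (hq : IsPrimePow q) (hodd : Odd q)
    (F F2 : Type) [Field F] [Fintype F]
    [Field F2] [Fintype F2] [Algebra F F2]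
    (hF : Fintype.card F = q) (hF2 : Fintype.card F2 = q ^ 2)
    (ξ : F2) (hξ : IsPrimitiveRoot ξ (2 * q + 2))
    (C : Set (Fin (2 * q + 2) → F))
    (hC : C = {c | ∀ α ∈ ({1, ξ, ξ⁻¹, ξ ^ q, (ξ ^ q)⁻¹, ξ ^ 2, ξ ^ (2 * q)} : Set F2),
      ∑ i : Fin (2 * q + 2), algebraMap F F2 (c i) * α ^ (i : ℕ) = 0}) :
    ∀ ℓ : ℕ, 5 ≤ ℓ → ℓ ≤ 2 * q + 2 - 3 →
      ¬ ∃ c ∈ C, ∀ i : Fin (2 * q + 2),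
        c i ≠ 0 ↔ ((i : ℕ) = 0 ∨ (i : ℕ) = 1 ∨ (i : ℕ) = 2 ∨ (i : ℕ) = 3 ∨
          (i : ℕ) = ℓ ∨ (i : ℕ) = ℓ + 1) := by
  rintro ℓ hl5 hl ⟨c, hcC, hsupp⟩
  rw [hC] at hcC
  have hq1 : 1 < q := hq.one_lt
  have hq3 : 3 ≤ q := by obtain ⟨k, rfl⟩ := hodd; omega
  have hne : ∀ i : ℕ, ∀ hi : i < 2 * q + 2,
      (i = 0 ∨ i = 1 ∨ i = 2 ∨ i = 3 ∨ i = ℓ ∨ i = ℓ + 1) →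
      algebraMap F F2 (c ⟨i, hi⟩) ≠ 0 := fun i hi h =>
    (map_ne_zero _).2 ((hsupp ⟨i, hi⟩).2 h)
  have hev : ∀ α ∈ ({1, ξ, ξ⁻¹, ξ ^ q, (ξ ^ q)⁻¹, ξ ^ 2, ξ ^ (2 * q)} : Set F2), _ :=
    fun α hα => (sum_fin_eq_of_support (ℓ := ℓ) (by omega) (by omega) _ (fun i hi => by
      rw [not_not.1 (mt (hsupp i).1 hi), map_zero, zero_mul])).symm.trans (hcC α hα)
  simp only [pow_zero, mul_one, pow_one] at hev
  have hc0 := hne 0 (by omega) (by omega)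
  have hc1 := hne 1 (by omega) (by omega)
  have hc2 := hne 2 (by omega) (by omega)
  have ha := hne ℓ (by omega) (by omega)
  have hb := hne (ℓ + 1) (by omega) (by omega)
  have hx : ξ ≠ 0 := hξ.ne_zero (by omega)
  have hpow : ∀ k : ℕ, 0 < k → k < 2 * q + 2 → ξ ^ k ≠ 1 := fun k h0 h1 =>
    hξ.pow_ne_one_of_pos_of_lt h0.ne' h1
  have hneg : ξ ^ (q + 1) = -1 := by
    have h : (ξ ^ (q + 1)) ^ 2 = 1 := by
      rw [← pow_mul, show (q + 1) * 2 = 2 * q + 2 by ring, hξ.pow_eq_one]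
    exact (eq_or_eq_neg_of_sq_eq_sq _ _ (h.trans (one_pow 2).symm)).resolve_left (hpow _ (by omega) (by omega))
  have h2 : (2 : F2) ≠ 0 := fun h =>
    hpow (q + 1) (by omega) (by omega) (by rw [hneg]; linear_combination -h)
  have hxq : ξ ^ q = -ξ⁻¹ := by
    field_simp
    rw [← pow_succ, hneg]
  have hxq' : (ξ ^ q)⁻¹ = -ξ := by rw [hxq, inv_neg, inv_inv]
  have hx2q : ξ ^ (2 * q) = (ξ ^ 2)⁻¹ := by rw [mul_comm, pow_mul, hxq, neg_sq, inv_pow]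
  have hβ2 : (ξ ^ 2) ^ 2 ≠ 1 := by rw [← pow_mul]; exact hpow _ (by omega) (by omega)
  have hβ3 : (ξ ^ 2) ^ 3 ≠ 1 := by rw [← pow_mul]; exact hpow _ (by omega) (by omega)
  have E0 := hev 1 (by simp)
  have E1 := hev ξ (by simp)
  have E2 := hev ξ⁻¹ (by simp)
  have E3 := hev (ξ ^ q) (by simp)
  have E4 := hev (ξ ^ q)⁻¹ (by simp)
  have E5 := hev (ξ ^ 2) (by simp)
  have E6 := hev (ξ ^ (2 * q)) (by simp)
  rw [hxq] at E3
  rw [hxq'] at E4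
  rw [hx2q] at E6
  have hFr : ∀ r s : F, s ≠ 0 → algebraMap F F2 r + algebraMap F F2 s * ξ ^ 2 ≠ 0 := by
    intro r s hs h
    have hs' : algebraMap F F2 s ≠ 0 := (map_ne_zero _).2 hs
    have hβ : ξ ^ 2 = algebraMap F F2 (-r / s) := by
      rw [map_div₀, map_neg]
      field_simp
      linear_combination h
    have hfix : (ξ ^ 2) ^ q = ξ ^ 2 := by
      rw [hβ, ← map_pow, ← hF, FiniteField.pow_card]
    rw [← pow_mul, hx2q] at hfix
    apply hβ2
    calc (ξ ^ 2) ^ 2 = (ξ ^ 2)⁻¹ * ξ ^ 2 := by rw [hfix, sq]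
      _ = 1 := inv_mul_cancel₀ (pow_ne_zero _ hx)
  rcases Nat.even_or_odd' ℓ with ⟨m, rfl | rfl⟩
  · obtain ⟨e1, o1⟩ := parts_vanish_of_even h2 hx m E1 E4
    obtain ⟨e2, o2⟩ := parts_vanish_of_even h2 (inv_ne_zero hx) m E2 E3
    refine no_codeword_even (β := ξ ^ 2) (B := ξ⁻¹ ^ 2) (y := (ξ ^ 2) ^ m)
      (Y := (ξ⁻¹ ^ 2) ^ m) ?_ ?_ hc0 hc2 ha hβ2 hβ3 ?_ ?_ e1 e2 o1 o2 ?_ ?_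
    · rw [← mul_pow, mul_inv_cancel₀ hx, one_pow]
    · rw [← mul_pow, ← mul_pow, mul_inv_cancel₀ hx, one_pow, one_pow]
    · exact hFr _ _ ((map_ne_zero _).1 hc1)
    · intro h
      refine hFr (c ⟨1, by omega⟩) _ ((map_ne_zero _).1 hc0) ?_
      field_simp at h
      linear_combination h
    · rw [← E5]; ring
    · rw [← E6]; ring
  · obtain ⟨e1, o1⟩ := parts_vanish_of_odd h2 hx m E1 E4
    obtain ⟨e2, o2⟩ := parts_vanish_of_odd h2 (inv_ne_zero hx) m E2 E3
    simp only [inv_pow] at e2 o2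
    have hz : (ξ ^ 2) ^ m ≠ 0 := pow_ne_zero _ (pow_ne_zero _ hx)
    have hβ : ξ ^ 2 ≠ 0 := pow_ne_zero _ hx
    rw [show (ξ ^ 2) ^ (2 * m + 1) = ((ξ ^ 2) ^ m) ^ 2 * ξ ^ 2 by ring,
      show (ξ ^ 2) ^ (2 * m + 1 + 1) = ((ξ ^ 2) ^ m) ^ 2 * (ξ ^ 2) ^ 2 by ring] at E5
    simp only [one_pow, mul_one] at E0
    generalize (ξ ^ 2) ^ m = z at *
    generalize ξ ^ 2 = β at *
    refine no_codeword_odd (β := β) (y := z * β) hβ (mul_ne_zero hz hβ) hc0 hc2 hb hβ2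
      e1 ?_ ?_ ?_ E0 ?_
    · field_simp at e2
      linear_combination β * e2
    · linear_combination β * o1
    · field_simp at o2
      linear_combination β * o2
    · linear_combination β * E5
end

section
/- Let q be an odd prime power, n = 2q+2, ξ ∈ F_{q^2} a primitive n-th root of unity, and let C ⊆ F_q^n be the cyclic code C = {c ∈ F_q^n : c(α) = 0 for every α ∈ {1, ξ, ξ^{-1}, ξ^q, ξ^{-q}, ξ^2, ξ^{2q}}, evaluation in F_{q^2}}. Then for every integer ℓ with 4 ≤ ℓ ≤ n-4, there is no codeword c ∈ C whose support is exactly {0, 1, 2, ℓ, ℓ+1, ℓ+2}; equivalently, C contains no codeword of the form (⋆,⋆,⋆,0_r,⋆,⋆,⋆,0_{n-r-6}) with each ⋆ a nonzero element of F_q and 1 ≤ r ≤ n-7. -/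
/-- Evaluating at `α` a word of length `n` supported on `{0, 1, 2, ℓ, ℓ+1, ℓ+2}`. -/
theorem exists_sum_eq_of_support {F K : Type*} [Field F] [Field K] [Algebra F K] {n ℓ : ℕ}
    (hℓ : 4 ≤ ℓ) (hn : ℓ + 2 < n) (c : Fin n → F)
    (hc : ∀ i : Fin n, c i ≠ 0 ↔ ((i : ℕ) = 0 ∨ (i : ℕ) = 1 ∨ (i : ℕ) = 2 ∨
      (i : ℕ) = ℓ ∨ (i : ℕ) = ℓ + 1 ∨ (i : ℕ) = ℓ + 2)) :
    ∃ a₀ a₁ a₂ b₀ b₁ b₂ : K, a₀ ≠ 0 ∧ b₁ ≠ 0 ∧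
      ∀ α : K, ∑ i : Fin n, algebraMap F K (c i) * α ^ (i : ℕ) =
        a₀ + a₁ * α + a₂ * α ^ 2 + α ^ ℓ * (b₀ + b₁ * α + b₂ * α ^ 2) := by
  let d : ℕ → K := fun k => if h : k < n then algebraMap F K (c ⟨k, h⟩) else 0
  have hd : ∀ i : Fin n, algebraMap F K (c i) = d i := fun i => by simp [d]
  have hd_ne : ∀ k (h : k < n), c ⟨k, h⟩ ≠ 0 → d k ≠ 0 := fun k h hk => by simpa [d, h] using hk
  refine ⟨d 0, d 1, d 2, d ℓ, d (ℓ + 1), d (ℓ + 2), hd_ne 0 (by omega) ((hc _).2 (by simp)),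
    hd_ne (ℓ + 1) (by omega) ((hc _).2 (by simp)), fun α => ?_⟩
  simp only [hd]
  rw [Fin.sum_univ_eq_sum_range (fun k => d k * α ^ k) n]
  have hsub : ({0, 1, 2, ℓ, ℓ + 1, ℓ + 2} : Finset ℕ) ⊆ Finset.range n := by
    intro k hk
    simp only [Finset.mem_insert, Finset.mem_singleton] at hk
    simp only [Finset.mem_range]
    omega
  rw [← Finset.sum_subset hsub]
  · have h0 : (0 : ℕ) ∉ ({1, 2, ℓ, ℓ + 1, ℓ + 2} : Finset ℕ) := by simp; omega
    have h1 : (1 : ℕ) ∉ ({2, ℓ, ℓ + 1, ℓ + 2} : Finset ℕ) := by simp; omega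
    have h2 : (2 : ℕ) ∉ ({ℓ, ℓ + 1, ℓ + 2} : Finset ℕ) := by simp; omega
    have h3 : ℓ ∉ ({ℓ + 1, ℓ + 2} : Finset ℕ) := by simp
    have h4 : ℓ + 1 ∉ ({ℓ + 2} : Finset ℕ) := by simp
    rw [Finset.sum_insert h0, Finset.sum_insert h1, Finset.sum_insert h2, Finset.sum_insert h3,
      Finset.sum_insert h4, Finset.sum_singleton]
    ring
  · intro k hk hk'
    have hkn : k < n := by simpa using hk
    have : c ⟨k, hkn⟩ = 0 := by
      by_contra h
      exact hk' (by simpa using (hc _).1 h)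
    simp [d, hkn, this]

/-- A quadratic polynomial vanishing at the distinct points `1`, `β`, `β⁻¹` has zero constant
term. -/
theorem constant_coeff_eq_zero_of_three_roots {K : Type*} [Field K] {a₀ a₁ a₂ β : K}
    (hβ2 : β ^ 2 ≠ 1) (h1 : a₀ + a₁ + a₂ = 0)
    (h2 : a₀ + a₁ * β + a₂ * β ^ 2 = 0) (h3 : a₀ * β ^ 2 + a₁ * β + a₂ = 0) : a₀ = 0 := by
  have h4 : (β ^ 2 - 1) * (a₀ - a₂) = 0 := by linear_combination h3 - h2
  have h5 : a₀ = a₂ := sub_eq_zero.1 ((mul_eq_zero.1 h4).resolve_left (sub_ne_zero.2 hβ2))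
  have h6 : a₀ * (β - 1) ^ 2 = 0 := by linear_combination h2 - β * h1 + (β ^ 2 - β) * h5
  have h7 : β - 1 ≠ 0 := fun h => hβ2 (by linear_combination (β + 1) * h)
  exact (mul_eq_zero.1 h6).resolve_right (pow_ne_zero 2 h7)

/-- The linear system satisfied by a codeword supported on `{0, 1, 2, ℓ, ℓ+1, ℓ+2}` when `ℓ`
is odd has no solution with `b₁ ≠ 0`; here `β = ξ ^ 2` and `u = ξ ^ (ℓ + 1)`. -/
theorem coeff_eq_zero_of_odd_gap {K : Type*} [Field K] {a₀ a₁ a₂ b₀ b₁ b₂ β u : K}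
    (hβ : β ≠ 0) (hβ2 : β ^ 2 ≠ 1) (hu1 : u ≠ 1) (huβ : u ≠ β) (huβ2 : u ^ 2 ≠ β)
    (e1 : a₀ + a₂ * β + b₁ * u = 0) (e2 : a₀ * β * u + a₂ * u + b₁ * β = 0)
    (e3 : a₁ * β + b₀ * u + b₂ * u * β = 0) (e4 : a₁ * u + b₀ * β + b₂ = 0)
    (e5 : a₀ + a₁ + a₂ + b₀ + b₁ + b₂ = 0)
    (e6 : a₀ * β + a₁ * β ^ 2 + a₂ * β ^ 3 + u ^ 2 * (b₀ + b₁ * β + b₂ * β ^ 2) = 0) :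
    b₁ = 0 := by
  have hβ1 : β - 1 ≠ 0 := fun h => hβ2 (by linear_combination (β + 1) * h)
  have hu1' := sub_ne_zero.2 hu1
  have huβ' := sub_ne_zero.2 huβ
  have huβ2' := sub_ne_zero.2 huβ2
  have h2 : u * (β ^ 2 - 1) * a₂ = -(b₁ * β * (u ^ 2 - 1)) := by
    linear_combination β * u * e1 - e2
  have h0 : u * (β ^ 2 - 1) * a₀ = b₁ * (u ^ 2 - β ^ 2) := by
    linear_combination u * (β ^ 2 - 1) * e1 - β * h2
  have k0 : u * (β ^ 2 - 1) * b₀ = -(a₁ * β * (u ^ 2 - 1)) := by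
    linear_combination u * β * e4 - e3
  have k2 : u * (β ^ 2 - 1) * b₂ = a₁ * (u ^ 2 - β ^ 2) := by
    linear_combination u * (β ^ 2 - 1) * e4 - β * k0
  have h5 : (a₁ + b₁) * ((β - 1) * (u - 1) * (u - β)) = 0 := by
    linear_combination -u * (β ^ 2 - 1) * e5 + h2 + h0 + k0 + k2
  have h6 : a₁ + b₁ = 0 := by
    refine (mul_eq_zero.1 h5).resolve_right ?_
    exact mul_ne_zero (mul_ne_zero hβ1 hu1') huβ'
  have h7 : b₁ * (β * (β - 1) * (u ^ 2 - β) * (u - 1) * (u - β)) = 0 := by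
    linear_combination -u * (β ^ 2 - 1) * e6 + β * h0 + β ^ 3 * h2 + u ^ 2 * k0 +
      u ^ 2 * β ^ 2 * k2 + (β ^ 2 * (u * (β ^ 2 - 1)) - u ^ 2 * β * (u ^ 2 - 1) +
        u ^ 2 * β ^ 2 * (u ^ 2 - β ^ 2)) * h6
  refine (mul_eq_zero.1 h7).resolve_right ?_
  exact mul_ne_zero (mul_ne_zero (mul_ne_zero (mul_ne_zero hβ hβ1) huβ2') hu1') huβ'

/-- For an odd prime power `q` and `n = 2q+2`, the cyclic code
`C = {c ∈ F_q^n : c(α) = 0 for all α ∈ {1, ξ, ξ⁻¹, ξ^q, ξ^{-q}, ξ^2, ξ^{2q}}}` contains,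
for every `4 ≤ ℓ ≤ n-4`, no codeword whose support is exactly `{0, 1, 2, ℓ, ℓ+1, ℓ+2}`. -/
theorem stmt_13 (q : ℕ) (hq : IsPrimePow q) (hodd : Odd q)
    (F F2 : Type) [Field F] [Fintype F]
    [Field F2] [Fintype F2] [Algebra F F2]
    (hF : Fintype.card F = q) (hF2 : Fintype.card F2 = q ^ 2)
    (ξ : F2) (hξ : IsPrimitiveRoot ξ (2 * q + 2))
    (C : Set (Fin (2 * q + 2) → F))
    (hC : C = {c | ∀ α ∈ ({1, ξ, ξ⁻¹, ξ ^ q, (ξ ^ q)⁻¹, ξ ^ 2, ξ ^ (2 * q)} : Set F2),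
      ∑ i : Fin (2 * q + 2), algebraMap F F2 (c i) * α ^ (i : ℕ) = 0}) :
    ∀ ℓ : ℕ, 4 ≤ ℓ → ℓ ≤ 2 * q + 2 - 4 →
      ¬ ∃ c ∈ C, ∀ i : Fin (2 * q + 2),
        c i ≠ 0 ↔ ((i : ℕ) = 0 ∨ (i : ℕ) = 1 ∨ (i : ℕ) = 2 ∨
          (i : ℕ) = ℓ ∨ (i : ℕ) = ℓ + 1 ∨ (i : ℕ) = ℓ + 2) := by
  intro ℓ hℓ4 hℓn
  rintro ⟨c, hcC, hsupp⟩
  obtain ⟨a₀, a₁, a₂, b₀, b₁, b₂, ha₀, hb₁, hev⟩ :=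
    exists_sum_eq_of_support (K := F2) hℓ4 (by omega) c hsupp
  rw [hC, Set.mem_ofPred_eq] at hcC
  have hξ0 : ξ ≠ 0 := hξ.ne_zero (by omega)
  have hpow : ∀ k : ℕ, 0 < k → k < 2 * q + 2 → ξ ^ k ≠ 1 :=
    fun k hk hkn => hξ.pow_ne_one_of_pos_of_lt hk.ne' hkn
  have hξn : ξ ^ (2 * q + 2) = 1 := hξ.pow_eq_one
  have hhalf : ξ ^ (q + 1) = -1 := by
    have h : (ξ ^ (q + 1) - 1) * (ξ ^ (q + 1) + 1) = 0 := by
      linear_combination hξn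
    exact eq_neg_of_add_eq_zero_left
      ((mul_eq_zero.1 h).resolve_left (sub_ne_zero.2 (hpow _ (by omega) (by omega))))
  have htwo : (2 : F2) ≠ 0 := fun h =>
    hpow (q + 1) (by omega) (by omega) (by linear_combination hhalf - h)
  have hq1 : ξ ^ q = -ξ⁻¹ := by
    field_simp
    linear_combination hhalf
  have hq2 : ξ ^ (2 * q) = ξ⁻¹ ^ 2 := by
    field_simp
    linear_combination hξn
  have hβ2 : (ξ ^ 2) ^ 2 ≠ 1 := by
    rw [← pow_mul]
    exact hpow 4 (by omega) (by omega)
  have f1 := (hev 1).symm.trans (hcC 1 (by simp))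
  have f2 := (hev ξ).symm.trans (hcC ξ (by simp))
  have f3 := (hev ξ⁻¹).symm.trans (hcC ξ⁻¹ (by simp))
  have f4 := (hev (-ξ⁻¹)).symm.trans (hcC (-ξ⁻¹) (by simp [hq1]))
  have f5 := (hev (-ξ)).symm.trans (hcC (-ξ) (by simp [hq1]))
  have f6 := (hev (ξ ^ 2)).symm.trans (hcC (ξ ^ 2) (by simp))
  have f7 := (hev (ξ⁻¹ ^ 2)).symm.trans (hcC (ξ⁻¹ ^ 2) (by simp [hq2]))
  have hxy : ξ * ξ⁻¹ = 1 := mul_inv_cancel₀ hξ0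
  have hUV : ξ ^ ℓ * ξ⁻¹ ^ ℓ = 1 := by rw [← mul_pow, hxy, one_pow]
  have hβℓ : (ξ ^ 2) ^ ℓ = (ξ ^ ℓ) ^ 2 := by rw [← pow_mul, ← pow_mul, mul_comm]
  have hβℓ' : (ξ⁻¹ ^ 2) ^ ℓ = (ξ⁻¹ ^ ℓ) ^ 2 := by rw [← pow_mul, ← pow_mul, mul_comm]
  simp only [one_pow] at f1
  rw [hβℓ] at f6
  rw [hβℓ'] at f7
  have hξ2 : ξ ^ 2 ≠ 0 := pow_ne_zero 2 hξ0
  have hy0 : ξ⁻¹ ≠ 0 := inv_ne_zero hξ0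
  rcases Nat.even_or_odd ℓ with hℓ | hℓ
  · rw [hℓ.neg_pow] at f4 f5
    have g1 : a₁ + b₁ * ξ ^ ℓ = 0 := by
      have h : 2 * ξ * (a₁ + b₁ * ξ ^ ℓ) = 0 := by linear_combination f2 - f5
      exact (mul_eq_zero.1 h).resolve_left (mul_ne_zero htwo hξ0)
    have g2 : a₁ + b₁ * ξ⁻¹ ^ ℓ = 0 := by
      have h : 2 * ξ⁻¹ * (a₁ + b₁ * ξ⁻¹ ^ ℓ) = 0 := by linear_combination f3 - f4
      exact (mul_eq_zero.1 h).resolve_left (mul_ne_zero htwo hy0)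
    have hsq : ξ ^ (2 * ℓ) = 1 := by
      have h : b₁ * (ξ ^ (2 * ℓ) - 1) = 0 := by
        linear_combination ξ ^ ℓ * g1 - ξ ^ ℓ * g2 + b₁ * hUV
      exact sub_eq_zero.1 ((mul_eq_zero.1 h).resolve_left hb₁)
    have hℓq : ℓ = q + 1 := by
      obtain ⟨k, hk⟩ := hξ.dvd_of_pow_eq_one _ hsq
      have hk1 : k = 1 := by
        have : k < 2 := by
          by_contra! h
          have h' := Nat.mul_le_mul_left (2 * q + 2) h
          rw [← hk] at h'
          omega
        interval_cases k <;> omega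
      subst hk1
      omega
    have hU : ξ ^ ℓ = -1 := by rw [hℓq, hhalf]
    have hV : ξ⁻¹ ^ ℓ = -1 := by
      rw [hU] at hUV
      linear_combination -hUV
    rw [hU] at f2 f5 f6 g1
    rw [hV] at f3 f4 f7
    have g3 : (a₀ - b₀) + (a₂ - b₂) * ξ ^ 2 = 0 := by
      linear_combination f2 - ξ * g1
    have g4 : (a₀ - b₀) * ξ ^ 2 + (a₂ - b₂) = 0 := by
      linear_combination ξ ^ 2 * f3 - ξ ^ 2 * ξ⁻¹ * g1 - (a₂ - b₂) * (ξ * ξ⁻¹ + 1) * hxy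
    have g5 : a₂ = b₂ := by
      have h : (a₂ - b₂) * ((ξ ^ 2) ^ 2 - 1) = 0 := by linear_combination ξ ^ 2 * g3 - g4
      exact sub_eq_zero.1 ((mul_eq_zero.1 h).resolve_right (sub_ne_zero.2 hβ2))
    have g6 : a₀ = b₀ := by linear_combination g3 - ξ ^ 2 * g5
    subst g5 g6
    have g7 : b₁ = a₁ := by linear_combination -g1
    subst g7
    refine ha₀ (constant_coeff_eq_zero_of_three_roots (a₁ := b₁) (a₂ := a₂) hβ2 ?_ ?_ ?_) <;>
      refine (mul_eq_zero.1 ?_).resolve_left htwo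
    · linear_combination f1
    · linear_combination f6
    · linear_combination ξ ^ 4 * f7 - 2 * b₁ * ξ ^ 2 * (ξ * ξ⁻¹ + 1) * hxy -
        2 * a₂ * (ξ ^ 2 * ξ⁻¹ ^ 2 + 1) * (ξ * ξ⁻¹ + 1) * hxy
  · rw [hℓ.neg_pow] at f4 f5
    obtain ⟨m, hm⟩ := hℓ
    have p1 : a₀ + a₂ * ξ ^ 2 + b₁ * (ξ * ξ ^ ℓ) = 0 := by
      refine (mul_eq_zero.1 ?_).resolve_left htwo
      linear_combination f2 + f5
    have p2 : a₀ + a₂ * ξ⁻¹ ^ 2 + b₁ * (ξ⁻¹ * ξ⁻¹ ^ ℓ) = 0 := by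
      refine (mul_eq_zero.1 ?_).resolve_left htwo
      linear_combination f3 + f4
    have p3 : a₁ * ξ + b₀ * ξ ^ ℓ + b₂ * ξ ^ ℓ * ξ ^ 2 = 0 := by
      refine (mul_eq_zero.1 ?_).resolve_left htwo
      linear_combination f2 - f5
    have p4 : a₁ * ξ⁻¹ + b₀ * ξ⁻¹ ^ ℓ + b₂ * ξ⁻¹ ^ ℓ * ξ⁻¹ ^ 2 = 0 := by
      refine (mul_eq_zero.1 ?_).resolve_left htwo
      linear_combination f3 - f4
    have hu : ξ * ξ ^ ℓ = ξ ^ (ℓ + 1) := (pow_succ' ξ ℓ).symm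
    refine hb₁ (coeff_eq_zero_of_odd_gap (a₁ := a₁) (b₀ := b₀) (b₂ := b₂) (β := ξ ^ 2)
      (u := ξ * ξ ^ ℓ) hξ2 hβ2
      ?_ ?_ ?_ p1 ?_ ?_ ?_ ?_ ?_)
    · rw [hu]
      exact hpow _ (by omega) (by omega)
    · intro h
      have : ℓ + 1 = 2 := hξ.pow_inj (by omega) (by omega) (by rw [← hu, h])
      omega
    · intro h
      have h2 : ξ ^ (2 * ℓ) = 1 := by
        refine mul_left_cancel₀ hξ2 ?_
        linear_combination h
      obtain ⟨k, hk⟩ := hξ.dvd_of_pow_eq_one _ h2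
      have hk' : ℓ = (q + 1) * k := by linarith
      have : Even ℓ := hk' ▸ (hodd.add_one).mul_right k
      exact Nat.not_even_iff_odd.2 ⟨m, hm⟩ this
    · linear_combination ξ ^ 3 * ξ ^ ℓ * p2 - a₂ * ξ * ξ ^ ℓ * (ξ * ξ⁻¹ + 1) * hxy -
        b₁ * ξ ^ 2 * (ξ * ξ⁻¹ * hUV + hxy)
    · linear_combination ξ * p3
    · linear_combination ξ ^ 2 * ξ ^ ℓ * p4 - a₁ * ξ * ξ ^ ℓ * hxy - b₀ * ξ ^ 2 * hUV -
        b₂ * (ξ ^ 2 * ξ⁻¹ ^ 2 * hUV + (ξ * ξ⁻¹ + 1) * hxy)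
    · linear_combination f1
    · linear_combination ξ ^ 2 * f6
end

section
/- Let q be an odd prime power and n a positive integer. Let g_1(x), g_2(x) ∈ F_q[x] be monic polynomials with g_1(x) dividing x^n - 1 and g_2(x) dividing x^n + 1. Let C = {c ∈ F_q^{2n} : g_1(x)g_2(x) divides c(x)} be the cyclic code of length 2n with generator polynomial g_1(x)g_2(x), let C_1 = {u ∈ F_q^n : g_1(x) divides u(x)} be the cyclic code of length n with generator polynomial g_1(x), and let C_2 = {v ∈ F_q^n : g_2(x) divides v(x)} be the negacyclic code of length n with generator polynomial g_2(x). Then C = {(u+v, u-v) : u ∈ C_1, v ∈ C_2}, where (u+v, u-v) ∈ F_q^{2n} denotes the concatenation of the vectors u+v and u-v in F_q^n. -/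
open Polynomial in
theorem sum_C_mul_X_pow_append {F : Type*} [CommRing F] (n : ℕ) (a b : Fin n → F) :
    ∑ i : Fin (2 * n), C ((Fin.append a b ∘ Fin.cast (two_mul n)) i) * X ^ (i : ℕ) =
      ∑ i : Fin n, C (a i) * X ^ (i : ℕ) + X ^ n * ∑ i : Fin n, C (b i) * X ^ (i : ℕ) := by
  have h : ∑ i : Fin (2 * n), C ((Fin.append a b ∘ Fin.cast (two_mul n)) i) * X ^ (i : ℕ) =
      ∑ i : Fin (n + n), C (Fin.append a b i) * (X : F[X]) ^ (i : ℕ) :=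
    Fintype.sum_equiv (finCongr (two_mul n)) _ _ fun _ => rfl
  rw [h, Fin.sum_univ_add, Finset.mul_sum]
  simp only [Fin.append_left, Fin.append_right, Fin.val_castAdd, Fin.val_natAdd, pow_add,
    mul_left_comm]

theorem Fin.exists_eq_append_add_sub {F : Type*} [Field F] (h2 : (2 : F) ≠ 0) (n : ℕ)
    (c : Fin (2 * n) → F) :
    ∃ u v : Fin n → F, c = Fin.append (u + v) (u - v) ∘ Fin.cast (two_mul n) := by
  let d : Fin (n + n) → F := c ∘ Fin.cast (two_mul n).symm
  refine ⟨fun i => (d (Fin.castAdd n i) + d (Fin.natAdd n i)) / 2,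
    fun i => (d (Fin.castAdd n i) - d (Fin.natAdd n i)) / 2, ?_⟩
  have hc : c = Fin.append (fun i => d (Fin.castAdd n i)) (fun i => d (Fin.natAdd n i)) ∘
      Fin.cast (two_mul n) := by
    rw [Fin.append_castAdd_natAdd]
    rfl
  refine hc.trans ?_
  congr 2 <;> funext i <;> simp only [Pi.add_apply, Pi.sub_apply] <;> field_simp <;> ring

theorem mul_dvd_add_add_mul_sub_iff {R : Type*} [CommRing R] (h2 : IsUnit (2 : R))
    {g₁ g₂ y : R} (hg1 : g₁ ∣ y - 1) (hg2 : g₂ ∣ y + 1) (u v : R) :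
    g₁ * g₂ ∣ (u + v) + y * (u - v) ↔ g₁ ∣ u ∧ g₂ ∣ v := by
  have hcop : IsCoprime g₁ g₂ := by
    obtain ⟨t, ht⟩ := h2.exists_left_inv
    exact IsCoprime.of_isCoprime_of_dvd_left
      (IsCoprime.of_isCoprime_of_dvd_right ⟨-t, t, by linear_combination ht⟩ hg2) hg1
  have h₁ : g₁ ∣ (u + v) + y * (u - v) ↔ g₁ ∣ u := by
    rw [show (u + v) + y * (u - v) = 2 * u + (y - 1) * (u - v) by ring,
      dvd_add_left (hg1.mul_right _), h2.dvd_mul_left]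
  have h₂ : g₂ ∣ (u + v) + y * (u - v) ↔ g₂ ∣ v := by
    rw [show (u + v) + y * (u - v) = 2 * v + (y + 1) * (u - v) by ring,
      dvd_add_left (hg2.mul_right _), h2.dvd_mul_left]
  rw [← h₁, ← h₂]
  exact ⟨fun h => ⟨dvd_of_mul_right_dvd h, dvd_of_mul_left_dvd h⟩,
    fun h => hcop.mul_dvd h.1 h.2⟩

/-- Let `q` be an odd prime power, `n > 0`, and `g₁, g₂ ∈ F_q[x]` monic with
`g₁ ∣ x^n - 1` and `g₂ ∣ x^n + 1`. Let `C` be the cyclic code of length `2n` with generator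
polynomial `g₁g₂`, `C₁` the cyclic code of length `n` with generator polynomial `g₁`, and
`C₂` the negacyclic code of length `n` with generator polynomial `g₂`. Then
`C = {(u+v, u-v) : u ∈ C₁, v ∈ C₂}` (concatenation of `u+v` and `u-v`). -/
theorem stmt_15 (q n : ℕ) (hq : IsPrimePow q) (hodd : Odd q) (hn : 0 < n)
    (F : Type) [Field F] [Fintype F] (hF : Fintype.card F = q)
    (g₁ g₂ : Polynomial F) (hm1 : g₁.Monic) (hm2 : g₂.Monic)
    (hg1 : g₁ ∣ Polynomial.X ^ n - 1) (hg2 : g₂ ∣ Polynomial.X ^ n + 1)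
    (C : Set (Fin (2 * n) → F)) (C₁ C₂ : Set (Fin n → F))
    (hC : C = {c | g₁ * g₂ ∣ ∑ i : Fin (2 * n), Polynomial.C (c i) * Polynomial.X ^ (i : ℕ)})
    (hC1 : C₁ = {u | g₁ ∣ ∑ i : Fin n, Polynomial.C (u i) * Polynomial.X ^ (i : ℕ)})
    (hC2 : C₂ = {v | g₂ ∣ ∑ i : Fin n, Polynomial.C (v i) * Polynomial.X ^ (i : ℕ)}) :
    C = {c | ∃ u ∈ C₁, ∃ v ∈ C₂,
      c = Fin.append (u + v) (u - v) ∘ Fin.cast (two_mul n)} := by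
  have h2 : (2 : F) ≠ 0 := Ring.two_ne_zero fun h => by
    have := FiniteField.even_card_of_char_two h
    rw [hF] at this
    exact absurd (Nat.odd_iff.mp hodd) (by omega)
  have h2' : IsUnit (2 : Polynomial F) := by
    have h := (Polynomial.isUnit_C (R := F)).mpr h2.isUnit
    rwa [map_ofNat] at h
  have key (u v : Fin n → F) : Fin.append (u + v) (u - v) ∘ Fin.cast (two_mul n) ∈ C ↔
      u ∈ C₁ ∧ v ∈ C₂ := by
    rw [hC, hC1, hC2]
    simp only [Set.mem_ofPred_eq]
    rw [sum_C_mul_X_pow_append, ← mul_dvd_add_add_mul_sub_iff h2' hg1 hg2]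
    simp only [Pi.add_apply, Pi.sub_apply, map_add, map_sub, add_mul, sub_mul,
      Finset.sum_add_distrib, Finset.sum_sub_distrib]
  ext c
  constructor
  · intro hc
    obtain ⟨u, v, rfl⟩ := Fin.exists_eq_append_add_sub h2 n c
    exact ⟨u, ((key u v).mp hc).1, v, ((key u v).mp hc).2, rfl⟩
  · rintro ⟨u, hu, v, hv, rfl⟩
    exact (key u v).mpr ⟨hu, hv⟩
end
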